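/- Let z₁ < z₂ and let u : (0,1) → {z₁, z₂} be measurable. Suppose that for every strictly decreasing assignment of values (i.e. for constants q₁ > q₂ and the function Q with Q(z₁) = q₁, Q(z₂) = q₂), the distributional derivative ∂ₓ(Q∘u) ≤ 0 on (0,1). Then there exists X ∈ [0,1] such that u(x) = z₁ for a.e. x < X and u(x) = z₂ for a.e. x > X. -/

import Mathlib

open Set MeasureTheory

open Filter Topology Convolution

/-- Testing a distributionally nonincreasing function against the primitive of the difference of
two translates of an even bump `η`. -/
lemma integral_bump_translate_le {f : ℝ → ℝ} (hf : LocallyIntegrable f)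
    (hdist : ∀ φ : ℝ → ℝ, ContDiff ℝ (⊤ : ℕ∞) φ → HasCompactSupport φ →
      tsupport φ ⊆ Ioo (0 : ℝ) 1 → (∀ x, 0 ≤ φ x) → 0 ≤ ∫ x, f x * deriv φ x)
    {η : ℝ → ℝ} (hη : ContDiff ℝ (⊤ : ℕ∞) η) (hη0 : ∀ x, 0 ≤ η x) {ε a b : ℝ}
    (hsupp : ∀ x, ε ≤ |x| → η x = 0) (hab : a < b) (ha : 0 < a - ε) (hb : b + ε < 1) :
    ∫ x, f x * η (x - b) ≤ ∫ x, f x * η (x - a) := by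
  have hηc : Continuous η := hη.continuous
  set H : ℝ → ℝ := fun x => ∫ t in (0 : ℝ)..x, η t with hH
  have hHd (x : ℝ) : HasDerivAt H (η x) x := hηc.integral_hasStrictDerivAt 0 x |>.hasDerivAt
  have hHs : ContDiff ℝ (⊤ : ℕ∞) H := by
    rw [contDiff_infty_iff_deriv]
    refine ⟨fun x => (hHd x).differentiableAt, ?_⟩
    rwa [show deriv H = η from funext fun x => (hHd x).deriv]
  set φ : ℝ → ℝ := fun x => H (x - a) - H (x - b) with hφ
  have hφi (x : ℝ) : φ x = ∫ t in (x - b)..(x - a), η t :=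
    intervalIntegral.integral_interval_sub_left (hηc.intervalIntegrable _ _)
      (hηc.intervalIntegrable _ _)
  have hφd : deriv φ = fun x => η (x - a) - η (x - b) := by
    funext x
    exact (((hHd (x - a)).comp_sub_const x a).sub ((hHd (x - b)).comp_sub_const x b)).deriv
  have hφ0 (x : ℝ) (hx : x ∉ Icc (a - ε) (b + ε)) : φ x = 0 := by
    rw [hφi]
    refine intervalIntegral.integral_zero_ae (Eventually.of_forall fun t ht => hsupp t ?_)
    rw [uIoc_of_le (by linarith)] at ht
    by_cases h : a - ε ≤ x
    · have : b + ε < x := by by_contra! h'; exact hx ⟨h, h'⟩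
      exact le_abs.2 (Or.inl (by linarith [ht.1]))
    · exact le_abs.2 (Or.inr (by linarith [ht.2]))
  have hts : tsupport φ ⊆ Icc (a - ε) (b + ε) :=
    closure_minimal (Function.support_subset_iff'.2 hφ0) isClosed_Icc
  have key := hdist φ ((hHs.comp (contDiff_id.sub contDiff_const)).sub
      (hHs.comp (contDiff_id.sub contDiff_const)))
    (HasCompactSupport.intro isCompact_Icc hφ0)
    (fun x hx => ⟨ha.trans_le (hts hx).1, (hts hx).2.trans_lt hb⟩)
    (fun x => by
      rw [hφi]
      exact intervalIntegral.integral_nonneg (by linarith) fun t _ => hη0 t)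
  have hint (c : ℝ) : Integrable fun x => f x * η (x - c) := by
    refine hf.integrable_smul_right_of_hasCompactSupport (by fun_prop) ?_
    refine HasCompactSupport.intro (isCompact_Icc (a := c - ε) (b := c + ε)) fun x hx => hsupp _ ?_
    by_contra! h
    rw [abs_lt] at h
    exact hx ⟨by linarith, by linarith⟩
  rw [hφd] at key
  simp only [mul_sub] at key
  rw [integral_sub (hint a) (hint b)] at key
  linarith

/-- A locally integrable function whose distributional derivative on `(0, 1)` is nonpositive
is a.e. equal to a nonincreasing function there. -/
lemma exists_ae_antitone_of_deriv_nonpos {f : ℝ → ℝ} (hf : LocallyIntegrable f)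
    (hdist : ∀ φ : ℝ → ℝ, ContDiff ℝ (⊤ : ℕ∞) φ → HasCompactSupport φ →
      tsupport φ ⊆ Ioo (0 : ℝ) 1 → (∀ x, 0 ≤ φ x) → 0 ≤ ∫ x, f x * deriv φ x) :
    ∃ S : Set ℝ, (∀ᵐ x, x ∈ S) ∧ AntitoneOn f (S ∩ Ioo 0 1) := by
  let ψ : ℕ → ContDiffBump (0 : ℝ) := fun n =>
    ⟨1 / (2 * ((n : ℝ) + 1)), 1 / ((n : ℝ) + 1), by positivity, by
      apply one_div_lt_one_div_of_lt <;> linarith [(n.cast_nonneg : (0 : ℝ) ≤ n)]⟩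
  have hψ : Tendsto (fun n => (ψ n).rOut) atTop (𝓝 0) := tendsto_one_div_add_atTop_nhds_zero_nat
  have hlim := ContDiffBump.ae_convolution_tendsto_right_of_locallyIntegrable
    (μ := volume) (φ := ψ) (K := 2) hψ
    (Eventually.of_forall fun n => by
      change 1 / ((n : ℝ) + 1) ≤ 2 * (1 / (2 * ((n : ℝ) + 1)))
      apply le_of_eq
      field_simp) hf
  refine ⟨_, hlim, fun a ha b hb hab => ?_⟩
  rcases hab.eq_or_lt with rfl | hab
  · rfl
  have hconv (n : ℕ) (c : ℝ) :
      ((ψ n).normed volume ⋆[ContinuousLinearMap.lsmul ℝ ℝ, volume] f) c =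
        ∫ x, f x * (ψ n).normed volume (x - c) := by
    rw [convolution_lsmul_swap]
    refine integral_congr_ae (Eventually.of_forall fun x => ?_)
    dsimp only
    rw [← (ψ n).normed_neg, neg_sub, smul_eq_mul, mul_comm]
  refine le_of_tendsto_of_tendsto hb.1 ha.1 ?_
  filter_upwards [hψ.eventually_lt_const ha.2.1,
    hψ.eventually_lt_const (sub_pos.2 hb.2.2)] with n hna hnb
  rw [hconv, hconv]
  refine integral_bump_translate_le (ε := (ψ n).rOut) hf hdist (ψ n).contDiff_normed
    (ψ n).nonneg_normed (fun x hx => ?_) hab (by linarith) (by linarith)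
  rw [← Function.notMem_support, (ψ n).support_normed_eq]
  simpa using hx

theorem quasistatic_stmt9 (z₁ z₂ : ℝ) (hz : z₁ < z₂)
    (u : ℝ → ℝ) (hmeas : Measurable u)
    (hval : ∀ x ∈ Set.Ioo (0:ℝ) 1, u x = z₁ ∨ u x = z₂)
    (hQ : ∀ q₁ q₂ : ℝ, q₂ < q₁ → ∀ φ : ℝ → ℝ, ContDiff ℝ (⊤ : ℕ∞) φ →
      HasCompactSupport φ → tsupport φ ⊆ Set.Ioo (0:ℝ) 1 → (∀ x, 0 ≤ φ x) →
      0 ≤ ∫ x in Set.Ioo (0:ℝ) 1, (if u x = z₁ then q₁ else q₂) * deriv φ x) :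
    ∃ X ∈ Set.Icc (0:ℝ) 1,
      (∀ᵐ x ∂(volume : Measure ℝ), x ∈ Set.Ioo 0 X → u x = z₁) ∧
      (∀ᵐ x ∂(volume : Measure ℝ), x ∈ Set.Ioo X 1 → u x = z₂) := by
  set A : Set ℝ := Ioo 0 1 ∩ u ⁻¹' {z₁} with hA
  have hAm : MeasurableSet A := measurableSet_Ioo.inter (hmeas (measurableSet_singleton z₁))
  have hf : LocallyIntegrable (A.indicator fun _ => (1 : ℝ)) :=
    (locallyIntegrable_const 1).indicator hAm
  obtain ⟨S, hS, hanti⟩ := exists_ae_antitone_of_deriv_nonpos hf fun φ h₁ h₂ h₃ h₄ => by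
    refine (hQ 1 0 one_pos φ h₁ h₂ h₃ h₄).trans_eq ?_
    rw [← integral_indicator measurableSet_Ioo]
    congr 1 with x
    by_cases hx : x ∈ Ioo (0 : ℝ) 1 <;> by_cases hu : u x = z₁ <;>
      simp only [indicator, hA, mem_inter_iff, mem_preimage, mem_singleton_iff, hx, hu] <;> simp
  have hmem {x y : ℝ} (hx : x ∈ S ∩ Ioo 0 1) (hy : y ∈ S ∩ A) (hxy : x ≤ y) : x ∈ A := by
    by_contra hxA
    have := hanti hx ⟨hy.1, hy.2.1⟩ hxy
    rw [indicator_of_mem hy.2, indicator_of_notMem hxA] at this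
    linarith
  set B : Set ℝ := insert 0 (S ∩ A) with hB
  have hB1 : ∀ x ∈ B, x ≤ 1 := by
    rintro x (rfl | hx)
    · exact zero_le_one
    · exact hx.2.1.2.le
  have hBb : BddAbove B := ⟨1, hB1⟩
  have hX0 : 0 ≤ sSup B := le_csSup hBb (mem_insert _ _)
  have hX1 : sSup B ≤ 1 := csSup_le (insert_nonempty _ _) hB1
  refine ⟨sSup B, ⟨hX0, hX1⟩, ?_, ?_⟩
  · filter_upwards [hS] with x hxS hx
    obtain ⟨y, hy, hxy⟩ := exists_lt_of_lt_csSup (insert_nonempty _ _) hx.2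
    rcases hy with rfl | hy
    · exact absurd hx.1 hxy.not_gt
    · exact (hmem ⟨hxS, hx.1, hx.2.trans_le hX1⟩ hy hxy.le).2
  · filter_upwards [hS] with x hxS hx
    have hx01 : x ∈ Ioo (0 : ℝ) 1 := ⟨hX0.trans_lt hx.1, hx.2⟩
    refine (hval x hx01).resolve_left fun hu => ?_
    exact hx.1.not_ge (le_csSup hBb (mem_insert_of_mem _ ⟨hxS, hx01, hu⟩))
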